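/- Control of the alignment error term: let K : ℝ^d × ℝ^d → ℝ be measurable with 0 ≤ K ≤ C_K, let ϱ, q : ℝ^d → (0,∞) be integrable and u, v : ℝ^d → ℝ^d with u ∈ L^∞. Then ∫∫ K(x,y) q(x) (ϱ(y) - q(y)) (u(y) - u(x)) · (v(x) - u(x)) dx dy ≤ 2 C_K ‖u‖_∞ ‖q‖_{L¹}^{1/2} (‖q‖_{L¹} + ‖ϱ‖_{L¹})^{1/2} (∫ p(q|ϱ) dy)^{1/2} (∫ q |v - u|² dx)^{1/2}, where p(q|ϱ) = ∫_ϱ^q (q-z)/z dz. -/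

import Mathlib

open MeasureTheory RealInnerProductSpace

lemma aux_pt (s t al be D c tau : ℝ) (hal : 0 < al) (hsum : al + be = 2 * D)
    (hc : 0 < c) (htau : 0 < tau) (hab : c * tau ≤ al * be) :
    (s + t) ^ 2 * be ≤ 2 * D * (s ^ 2 + t ^ 2) + s ^ 2 * (4 * D ^ 2 / (c * tau) * be - 4 * D) := by
  have h1 : 1 / al ≤ be / (c * tau) := by
    rw [div_le_div_iff₀ hal (by positivity)]; linarith
  have h2 : 2 * s * t * be ≤ t ^ 2 * al + s ^ 2 * (be ^ 2 / al) := by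
    have : t ^ 2 * al + s ^ 2 * (be ^ 2 / al) - 2 * s * t * be = (t * al - s * be) ^ 2 / al := by
      field_simp; ring
    have h3 : 0 ≤ (t * al - s * be) ^ 2 / al := by positivity
    linarith
  have h3 : be ^ 2 / al = 4 * D ^ 2 * (1 / al) - 4 * D + al := by
    have : be = 2 * D - al := by linarith
    rw [this]; field_simp; ring
  have h4 : be ^ 2 / al ≤ 4 * D ^ 2 / (c * tau) * be - 4 * D + al := by
    rw [h3]
    have := mul_le_mul_of_nonneg_left h1 (show 0 ≤ 4 * D ^ 2 by positivity)
    have e : 4 * D ^ 2 / (c * tau) * be = 4 * D ^ 2 * (be / (c * tau)) := by ring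
    linarith
  have h5 := mul_le_mul_of_nonneg_left h4 (sq_nonneg s)
  rw [← hsum]
  nlinarith

lemma aux_fin {E : Type*} [NormedAddCommGroup E] [InnerProductSpace ℝ E] {ι : Type*} [Fintype ι]
    [Nonempty ι] (a b : ι → ℝ) (ha : ∀ i, 0 < a i) (hb : ∀ i, 0 ≤ b i) (u : ι → E) (C0 C : ℝ)
    (hC : C0 < C) (hu : ∀ i, ‖u i‖ ≤ C0) :
    ∑ i, ∑ j, a i * (√(a j) + √(b j)) ^ 2 * ‖u i - u j‖ ^ 2
      ≤ 4 * C ^ 2 * (∑ i, a i) * ∑ i, (a i + b i) := by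
  have hC0 : 0 ≤ C0 := (norm_nonneg _).trans (hu (Classical.arbitrary ι))
  have hCp : 0 < C := hC0.trans_lt hC
  set A := ∑ i, a i with hA
  have hAp : 0 < A := Finset.sum_pos (fun i _ => ha i) Finset.univ_nonempty
  set U := ∑ i, a i • u i with hU
  have hUn : ‖U‖ ≤ A * C0 := by
    rw [hA, Finset.sum_mul]
    refine (norm_sum_le _ _).trans (Finset.sum_le_sum fun i _ => ?_)
    rw [norm_smul, Real.norm_of_nonneg (ha i).le]
    exact mul_le_mul_of_nonneg_left (hu i) (ha i).le
  have hUC : ‖U‖ < A * C := hUn.trans_lt (mul_lt_mul_of_pos_left hC hAp)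
  set tau := A ^ 2 * C ^ 2 - ‖U‖ ^ 2 with htau
  have htp : 0 < tau := by
    have := norm_nonneg U
    rw [htau]; nlinarith
  have hin : ∀ j, |⟪U, u j⟫| ≤ ‖U‖ * C := fun j =>
    (abs_real_inner_le_norm _ _).trans
      (mul_le_mul_of_nonneg_left ((hu j).trans hC.le) (norm_nonneg _))
  have h1 : ∀ j, ∑ i, a i * ‖u i - u j‖ ^ 2 ≤ 2 * (A * C ^ 2 - ⟪U, u j⟫) := by
    intro j
    have : 2 * (A * C ^ 2 - ⟪U, u j⟫) = ∑ i, a i * (2 * C ^ 2 - 2 * ⟪u i, u j⟫) := by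
      simp only [hU, hA, sum_inner, inner_smul_left, Finset.sum_mul, mul_sub, Finset.sum_sub_distrib,
        Finset.mul_sum]
      congr 1
      · exact Finset.sum_congr rfl fun i _ => by ring
      · exact Finset.sum_congr rfl fun i _ => by simp; ring
    rw [this]
    refine Finset.sum_le_sum fun i _ => mul_le_mul_of_nonneg_left ?_ (ha i).le
    rw [norm_sub_sq_real]
    have h1 := pow_le_pow_left₀ (norm_nonneg _) ((hu i).trans hC.le) 2
    have h2 := pow_le_pow_left₀ (norm_nonneg _) ((hu j).trans hC.le) 2
    linarith
  have h2 : ∀ j, (√(a j) + √(b j)) ^ 2 * (A * C ^ 2 - ⟪U, u j⟫) ≤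
      2 * (A * C ^ 2) * (a j + b j) + a j * (4 * (A * C ^ 2) ^ 2 / (C ^ 2 * tau) *
        (A * C ^ 2 - ⟪U, u j⟫) - 4 * (A * C ^ 2)) := by
    intro j
    have hj := abs_le.1 (hin j)
    have hlt : ‖U‖ * C < A * C ^ 2 := by nlinarith
    have := aux_pt (√(a j)) (√(b j)) (A * C ^ 2 + ⟪U, u j⟫) (A * C ^ 2 - ⟪U, u j⟫) (A * C ^ 2)
      (C ^ 2) tau (by linarith) (by ring) (by positivity) htp (by
        have : ⟪U, u j⟫ ^ 2 ≤ (‖U‖ * C) ^ 2 := sq_le_sq' hj.1 hj.2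
        rw [htau]; nlinarith)
    rwa [Real.sq_sqrt (ha j).le, Real.sq_sqrt (hb j)] at this
  have h3 : ∑ j, a j * (A * C ^ 2 - ⟪U, u j⟫) = tau := by
    simp only [mul_sub, Finset.sum_sub_distrib, ← Finset.sum_mul, ← hA]
    have : ∑ j, a j * ⟪U, u j⟫ = ‖U‖ ^ 2 := by
      rw [← real_inner_self_eq_norm_sq]
      conv_rhs => rw [hU, ← hU, inner_sum]
      simp [inner_smul_right]
    rw [this, htau]; ring
  rw [Finset.sum_comm]
  calc ∑ j, ∑ i, a i * (√(a j) + √(b j)) ^ 2 * ‖u i - u j‖ ^ 2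
      = ∑ j, (√(a j) + √(b j)) ^ 2 * ∑ i, a i * ‖u i - u j‖ ^ 2 := by
        refine Finset.sum_congr rfl fun j _ => ?_
        rw [Finset.mul_sum]
        exact Finset.sum_congr rfl fun i _ => by ring
    _ ≤ ∑ j, 2 * (2 * (A * C ^ 2) * (a j + b j) + (4 * (A * C ^ 2) ^ 2 / (C ^ 2 * tau) *
        (a j * (A * C ^ 2 - ⟪U, u j⟫)) - 4 * (A * C ^ 2) * a j)) := by
        refine Finset.sum_le_sum fun j _ => ?_
        have := mul_le_mul_of_nonneg_left (h1 j) (sq_nonneg (√(a j) + √(b j)))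
        have := h2 j
        linarith
    _ = 4 * C ^ 2 * A * ∑ i, (a i + b i) := by
        rw [← Finset.mul_sum, Finset.sum_add_distrib, Finset.sum_sub_distrib, ← Finset.mul_sum,
          ← Finset.mul_sum, ← Finset.mul_sum, h3, ← hA]
        field_simp
        ring

lemma aux_kl (q r : ℝ) (hq : 0 < q) (hr : 0 < r) :
    (r - q) ^ 2 ≤ (√q + √r) ^ 2 * ∫ z in r..q, (q - z) / z := by
  have e : ∫ z in r..q, (q - z) / z = q * Real.log (q / r) - (q - r) := by
    have hz : ∀ z ∈ Set.uIcc r q, z ≠ 0 := fun z hz => by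
      have := (lt_min hr hq).trans_le hz.1
      exact this.ne'
    have : ∫ z in r..q, (q - z) / z = ∫ z in r..q, (q * z⁻¹ - 1) :=
      intervalIntegral.integral_congr fun z h => by
        have := hz z h
        show (q - z) / z = q * z⁻¹ - 1
        field_simp
    rw [this, intervalIntegral.integral_sub, intervalIntegral.integral_const_mul,
      integral_inv_of_pos hr hq]
    · simp
    · exact (intervalIntegral.intervalIntegrable_inv hz continuousOn_id).const_mul _
    · simp
  rw [e]
  have h1 : √q ^ 2 = q := Real.sq_sqrt hq.le
  have h2 : √r ^ 2 = r := Real.sq_sqrt hr.le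
  have hs : 0 < √q := Real.sqrt_pos.2 hq
  have ht : 0 < √r := Real.sqrt_pos.2 hr
  set s := √q
  set t := √r
  have hl : Real.log (q / r) = - (2 * Real.log (t / s)) := by
    rw [← h1, ← h2, Real.log_div (by positivity) (by positivity), Real.log_pow, Real.log_pow,
      Real.log_div ht.ne' hs.ne']
    push_cast; ring
  have h3 := Real.log_le_sub_one_of_pos (div_pos ht hs)
  have h4 : (s - t) ^ 2 ≤ q * Real.log (q / r) - (q - r) := by
    rw [hl]
    have h5 := mul_le_mul_of_nonneg_left h3 hq.le
    have h6 : q * (t / s - 1) = s * t - s ^ 2 := by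
      rw [← h1]; field_simp
    nlinarith
  calc (r - q) ^ 2 = (s + t) ^ 2 * (s - t) ^ 2 := by rw [← h1, ← h2]; ring
    _ ≤ _ := mul_le_mul_of_nonneg_left h4 (sq_nonneg _)

lemma aux_cs {X : Type*} [MeasurableSpace X] {μ : Measure X} (f g : X → ℝ) (hf : ∀ x, 0 ≤ f x)
    (hg : ∀ x, 0 ≤ g x) (hfm : AEStronglyMeasurable f μ) (hgm : AEStronglyMeasurable g μ)
    (hf2 : Integrable (fun x => f x ^ 2) μ) (hg2 : Integrable (fun x => g x ^ 2) μ) :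
    Integrable (fun x => f x * g x) μ ∧
    ∫ x, f x * g x ∂μ ≤ √(∫ x, f x ^ 2 ∂μ) * √(∫ x, g x ^ 2 ∂μ) := by
  have h1 : MemLp f 2 μ := (memLp_two_iff_integrable_sq hfm).2 hf2
  have h2 : MemLp g 2 μ := (memLp_two_iff_integrable_sq hgm).2 hg2
  refine ⟨h1.integrable_mul h2, ?_⟩
  have := integral_mul_le_Lp_mul_Lq_of_nonneg (μ := μ) (p := 2) (q := 2)
    Real.HolderConjugate.two_two (Filter.Eventually.of_forall hf) (Filter.Eventually.of_forall hg)
    (by simpa using h1) (by simpa using h2)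
  simpa [Real.sqrt_eq_rpow] using this

lemma aux_m (a : ℝ) (h0 : 0 < a) (h1 : a < 1) : (√a + √(1 - a)) ^ 2 ≤ 2 := by
  have e1 := Real.sq_sqrt h0.le
  have e2 := Real.sq_sqrt (sub_pos.2 h1).le
  nlinarith [sq_nonneg (√a - √(1 - a))]

lemma aux_sample {E : Type*} [NormedAddCommGroup E] [InnerProductSpace ℝ E] {X : Type*}
    [MeasurableSpace X] (π : Measure X) [IsProbabilityMeasure π] (a : X → ℝ) (u : X → E) (C0 : ℝ)
    (ham : AEStronglyMeasurable a π) (ha0 : ∀ x, 0 < a x) (ha1 : ∀ x, a x < 1)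
    (hu : ∀ x, ‖u x‖ ≤ C0) (F : X × X → ℝ) (hFm : AEStronglyMeasurable F (π.prod π))
    (hF0 : ∀ z, 0 ≤ F z)
    (hF : ∀ z, F z ≤ a z.1 * (√(a z.2) + √(1 - a z.2)) ^ 2 * ‖u z.1 - u z.2‖ ^ 2) :
    ∫ z, F z ∂(π.prod π) ≤ 4 * C0 ^ 2 * ∫ x, a x ∂π := by
  have hai : Integrable a π := by
    refine Integrable.of_bound ham 1 (Filter.Eventually.of_forall fun x => ?_)
    rw [Real.norm_of_nonneg (ha0 x).le]; exact (ha1 x).le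
  have hFb : ∀ z, F z ≤ 1 * 2 * (C0 + C0) ^ 2 := by
    intro z
    refine (hF z).trans ?_
    have h1 := aux_m _ (ha0 z.2) (ha1 z.2)
    have h2 : ‖u z.1 - u z.2‖ ≤ C0 + C0 := (norm_sub_le _ _).trans (add_le_add (hu _) (hu _))
    have := (ha1 z.1).le
    gcongr
  have hFi : Integrable F (π.prod π) := by
    refine Integrable.of_bound hFm (1 * 2 * (C0 + C0) ^ 2) (Filter.Eventually.of_forall fun z => ?_)
    rw [Real.norm_of_nonneg (hF0 z)]; exact hFb z
  set I := ∫ z, F z ∂(π.prod π) with hI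
  set A := ∫ x, a x ∂π with hA
  -- sampling
  have key : ∀ (C : ℝ), C0 < C → ∀ n : ℕ, 0 < n → ((n:ℝ) * n - n) * I ≤ 4 * C ^ 2 * (n * A) * n := by
    intro C hC n hn
    have : Nonempty (Fin n) := ⟨⟨0, hn⟩⟩
    set P : Measure (Fin n → X) := Measure.pi (fun _ => π) with hP
    have mp1 : ∀ i : Fin n, MeasurePreserving (fun ω : Fin n → X => ω i) P π := fun i =>
      measurePreserving_eval (fun _ => π) i
    have mp2 : ∀ i j : Fin n, i ≠ j →
        MeasurePreserving (fun ω : Fin n → X => (ω i, ω j)) P (π.prod π) := by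
      intro i j hij
      refine ⟨by fun_prop, ?_⟩
      have h := (ProbabilityTheory.iIndepFun_pi (μ := fun _ : Fin n => π)
        (X := fun _ x => x) (fun _ => aemeasurable_id)).indepFun hij
      have h' := (ProbabilityTheory.indepFun_iff_map_prod_eq_prod_map_map
        (measurable_pi_apply i).aemeasurable (measurable_pi_apply j).aemeasurable).1 h
      rw [hP, h', ← hP, (mp1 i).map_eq, (mp1 j).map_eq]
    have hint : ∀ i j : Fin n, Integrable (fun ω : Fin n → X => if i = j then 0 else F (ω i, ω j)) P := by
      intro i j
      by_cases hij : i = j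
      · simp [hij]
      · simp only [hij, if_false]
        exact (mp2 i j hij).integrable_comp_of_integrable hFi
    have hval : ∀ i j : Fin n, ∫ ω, (if i = j then 0 else F (ω i, ω j)) ∂P = if i = j then 0 else I := by
      intro i j
      by_cases hij : i = j
      · simp [hij]
      · simp only [hij, if_false]
        rw [hI, ← (mp2 i j hij).map_eq, integral_map (mp2 i j hij).aemeasurable]
        rw [(mp2 i j hij).map_eq]; exact hFm
    have hia : ∀ i : Fin n, Integrable (fun ω : Fin n → X => a (ω i)) P := fun i =>
      (mp1 i).integrable_comp_of_integrable hai
    have hva : ∀ i : Fin n, ∫ ω, a (ω i) ∂P = A := by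
      intro i
      rw [hA, ← (mp1 i).map_eq, integral_map (mp1 i).aemeasurable]
      rw [(mp1 i).map_eq]; exact ham
    have hpt : ∀ ω : Fin n → X, ∑ i, ∑ j, (if i = j then 0 else F (ω i, ω j)) ≤
        4 * C ^ 2 * (∑ i, a (ω i)) * n := by
      intro ω
      have := aux_fin (fun i => a (ω i)) (fun i => 1 - a (ω i)) (fun i => ha0 _)
        (fun i => (sub_pos.2 (ha1 _)).le) (fun i => u (ω i)) C0 C hC (fun i => hu _)
      simp only [add_sub_cancel, Finset.sum_const, Finset.card_univ, Fintype.card_fin,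
        nsmul_eq_mul, mul_one] at this
      refine le_trans (Finset.sum_le_sum fun i _ => Finset.sum_le_sum fun j _ => ?_) this
      split_ifs with h
      · have := ha0 (ω i); positivity
      · exact hF (ω i, ω j)
    have hmono := integral_mono (μ := P)
      (integrable_finsetSum _ fun i _ => integrable_finsetSum _ fun j _ => hint i j)
      (((integrable_finsetSum _ fun i _ => hia i).const_mul (4 * C ^ 2)).mul_const (n:ℝ)) hpt
    rw [integral_finsetSum _ (fun i _ => integrable_finsetSum _ fun j _ => hint i j),
      integral_mul_const, integral_const_mul, integral_finsetSum _ (fun i _ => hia i)] at hmono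
    simp only [integral_finsetSum _ (fun j _ => hint _ j), hval, hva] at hmono
    have e : ∀ i : Fin n, ∑ j, (if i = j then 0 else I) = n * I - I := by
      intro i
      have : ∀ j, (if i = j then 0 else I) = I - if i = j then I else 0 := by
        intro j; split_ifs <;> simp
      simp [this, Finset.sum_sub_distrib]
    simp only [e, Finset.sum_const, Finset.card_univ, Fintype.card_fin, nsmul_eq_mul] at hmono
    linarith
  have key2 : ∀ C : ℝ, C0 < C → I ≤ 4 * C ^ 2 * A := by
    intro C hC
    have ht : Filter.Tendsto (fun n : ℕ => (1 - 1 / (n:ℝ)) * I) Filter.atTop (nhds ((1 - 0) * I)) :=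
      (tendsto_const_nhds.sub tendsto_one_div_atTop_nhds_zero_nat).mul_const I
    rw [sub_zero, one_mul] at ht
    refine le_of_tendsto ht (Filter.eventually_atTop.2 ⟨1, fun n hn => ?_⟩)
    have hn' : (0:ℝ) < n := by exact_mod_cast hn
    have := key C hC n hn
    have e : (1 - 1 / (n:ℝ)) * I = (((n:ℝ) * n - n) * I) / (n * n) := by field_simp
    rw [e, div_le_iff₀ (by positivity)]
    linarith
  have ht : Filter.Tendsto (fun C : ℝ => 4 * C ^ 2 * A) (nhdsWithin C0 (Set.Ioi C0))
      (nhds (4 * C0 ^ 2 * A)) :=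
    (Continuous.tendsto (by fun_prop) C0).mono_left nhdsWithin_le_nhds
  exact ge_of_tendsto ht (Filter.eventually_of_mem self_mem_nhdsWithin fun C hC => key2 C hC)

lemma aux_vol {E : Type*} [NormedAddCommGroup E] [InnerProductSpace ℝ E] {X : Type*}
    [MeasurableSpace X] (μ : Measure X) [SFinite μ] (hμ : μ ≠ 0) (q ρ : X → ℝ) (u : X → E) (C0 : ℝ)
    (hq : Integrable q μ) (hρ : Integrable ρ μ) (hq0 : ∀ x, 0 < q x) (hρ0 : ∀ x, 0 < ρ x)
    (hu : ∀ x, ‖u x‖ ≤ C0) (H : X × X → ℝ) (hHm : AEStronglyMeasurable H (μ.prod μ))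
    (hH0 : ∀ z, 0 ≤ H z) (hH : ∀ z, H z ≤ ‖u z.1 - u z.2‖) :
    Integrable (fun z : X × X => q z.1 * (√(q z.2) + √(ρ z.2)) ^ 2 * H z ^ 2) (μ.prod μ) ∧
    ∫ z, q z.1 * (√(q z.2) + √(ρ z.2)) ^ 2 * H z ^ 2 ∂(μ.prod μ)
      ≤ 4 * C0 ^ 2 * (∫ x, q x ∂μ) * ((∫ x, q x ∂μ) + ∫ x, ρ x ∂μ) := by
  have hqm := hq.aestronglyMeasurable
  have hρm := hρ.aestronglyMeasurable
  have hms : AEStronglyMeasurable (fun x => (√(q x) + √(ρ x)) ^ 2) μ :=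
    (((Real.continuous_sqrt.comp_aestronglyMeasurable hqm).add
      (Real.continuous_sqrt.comp_aestronglyMeasurable hρm)).pow 2)
  have hTm : AEStronglyMeasurable
      (fun z : X × X => q z.1 * (√(q z.2) + √(ρ z.2)) ^ 2 * H z ^ 2) (μ.prod μ) :=
    (hqm.comp_fst.mul hms.comp_snd).mul (hHm.pow 2)
  have hmb : ∀ x, (√(q x) + √(ρ x)) ^ 2 ≤ 2 * (q x + ρ x) := fun x => by
    have e1 := Real.sq_sqrt (hq0 x).le
    have e2 := Real.sq_sqrt (hρ0 x).le
    nlinarith [sq_nonneg (√(q x) - √(ρ x))]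
  have hC0 : ∀ z, H z ≤ C0 + C0 := fun z =>
    (hH z).trans ((norm_sub_le _ _).trans (add_le_add (hu _) (hu _)))
  constructor
  · refine Integrable.mono' ((hq.mul_prod ((hq.add hρ).const_mul 2)).mul_const ((C0 + C0) ^ 2)) hTm
      (Filter.Eventually.of_forall fun z => ?_)
    have h1 := hq0 z.1
    rw [Real.norm_of_nonneg (by positivity)]
    have := hmb z.2
    have := hC0 z
    have := hH0 z
    have := hq0 z.2
    have := hρ0 z.2
    simp only [Pi.add_apply]
    gcongr
  set Q := ∫ x, q x ∂μ
  set R := ∫ x, ρ x ∂μ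
  have hpos : ∀ f : X → ℝ, Integrable f μ → (∀ x, 0 < f x) → 0 < ∫ x, f x ∂μ := by
    intro f hf h0
    rw [integral_pos_iff_support_of_nonneg (fun x => (h0 x).le) hf]
    have : Function.support f = Set.univ := Set.eq_univ_of_forall fun x => (h0 x).ne'
    rw [this]; exact Measure.measure_univ_pos.2 hμ
  have hQ : 0 < Q := hpos q hq hq0
  have hR : 0 < R := hpos ρ hρ hρ0
  set S := Q + R with hS
  have hSp : 0 < S := by positivity
  set w : X → ℝ := fun x => (q x + ρ x) / S with hw
  have hw0 : ∀ x, 0 < w x := fun x => div_pos (add_pos (hq0 x) (hρ0 x)) hSp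
  have hwi : Integrable w μ := (hq.add hρ).div_const S
  have hw1 : ∫ x, w x ∂μ = 1 := by
    rw [hw, integral_div, integral_add hq hρ]; exact div_self hSp.ne'
  set D : X → ENNReal := fun x => ENNReal.ofReal (w x) with hD
  have hDm : AEMeasurable D μ := hwi.aemeasurable.ennreal_ofReal
  set π := μ.withDensity D with hπ
  have : IsProbabilityMeasure π := by
    constructor
    rw [hπ, withDensity_apply _ MeasurableSet.univ, Measure.restrict_univ, hD,
      ← ofReal_integral_eq_lintegral_ofReal hwi (Filter.Eventually.of_forall fun x => (hw0 x).le),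
      hw1, ENNReal.ofReal_one]
  have hac : π ≪ μ := withDensity_absolutelyContinuous _ _
  have hac2 : π.prod π ≪ μ.prod μ := hac.prod hac
  set a : X → ℝ := fun x => q x / (q x + ρ x) with ha
  have ham : AEStronglyMeasurable a μ :=
    (hqm.aemeasurable.div (hqm.aemeasurable.add hρm.aemeasurable)).aestronglyMeasurable
  have ha1 : ∀ x, 1 - a x = ρ x / (q x + ρ x) := fun x => by
    have := hq0 x; have := hρ0 x
    simp only [ha]; field_simp; ring
  have hmm : ∀ x, (√(a x) + √(1 - a x)) ^ 2 = (√(q x) + √(ρ x)) ^ 2 / (q x + ρ x) := fun x => by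
    have h1 := hq0 x; have h2 := hρ0 x
    rw [ha1, ha, Real.sqrt_div h1.le, Real.sqrt_div h2.le, ← add_div, div_pow,
      Real.sq_sqrt (by positivity)]
  have hmain := aux_sample π a u C0 (ham.mono_ac hac)
    (fun x => div_pos (hq0 x) (add_pos (hq0 x) (hρ0 x)))
    (fun x => (div_lt_one (add_pos (hq0 x) (hρ0 x))).2 (by linarith [hρ0 x])) hu
    (fun z => a z.1 * ((√(q z.2) + √(ρ z.2)) ^ 2 / (q z.2 + ρ z.2)) * H z ^ 2)
    (AEStronglyMeasurable.mono_ac hac2 ((ham.comp_fst.mul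
      (hms.aemeasurable.div (hqm.aemeasurable.add hρm.aemeasurable)).aestronglyMeasurable.comp_snd).mul
        (hHm.pow 2)))
    (fun z => by
      have := hq0 z.1; have := hρ0 z.1; have := hq0 z.2; have := hρ0 z.2
      simp only [ha]; positivity)
    (fun z => by
      rw [hmm]
      have := hq0 z.1; have := hρ0 z.1; have := hq0 z.2; have := hρ0 z.2
      have h3 := pow_le_pow_left₀ (hH0 z) (hH z) 2
      refine mul_le_mul_of_nonneg_left h3 ?_
      simp only [ha]; positivity)
  have hA : ∫ x, a x ∂π = Q / S := by
    rw [hπ, integral_withDensity_eq_integral_toReal_smul₀ hDm (by simp [hD]), ← integral_div]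
    refine integral_congr_ae (Filter.Eventually.of_forall fun x => ?_)
    have := hq0 x; have := hρ0 x
    simp only [hD, ENNReal.toReal_ofReal (hw0 x).le]
    simp only [hw, ha, smul_eq_mul]
    field_simp
  rw [hA, hπ, prod_withDensity₀ hDm hDm, integral_withDensity_eq_integral_toReal_smul₀
    (show AEMeasurable (fun z : X × X => D z.1 * D z.2) (μ.prod μ) from
      (hDm.comp_fst).mul (hDm.comp_snd))
    (Filter.Eventually.of_forall fun z => ENNReal.mul_lt_top (by simp [hD]) (by simp [hD]))] at hmain
  have e : ∀ z : X × X, (D z.1 * D z.2).toReal • (a z.1 * ((√(q z.2) + √(ρ z.2)) ^ 2 /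
      (q z.2 + ρ z.2)) * H z ^ 2) = (q z.1 * (√(q z.2) + √(ρ z.2)) ^ 2 * H z ^ 2) / S ^ 2 := by
    intro z
    have := hq0 z.1; have := hρ0 z.1; have := hq0 z.2; have := hρ0 z.2
    simp only [hD, ENNReal.toReal_mul, ENNReal.toReal_ofReal (hw0 _).le]
    simp only [hw, ha, smul_eq_mul]
    field_simp
  simp only [e] at hmain
  rw [integral_div, div_le_iff₀ (by positivity)] at hmain
  refine hmain.trans (le_of_eq ?_)
  field_simp

theorem alignment_error_control (d : ℕ) (CK Cu : ℝ)
    (K : EuclideanSpace ℝ (Fin d) → EuclideanSpace ℝ (Fin d) → ℝ)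
    (ρ q : EuclideanSpace ℝ (Fin d) → ℝ)
    (u v : EuclideanSpace ℝ (Fin d) → EuclideanSpace ℝ (Fin d))
    (hK0 : ∀ x y, 0 ≤ K x y) (hKC : ∀ x y, K x y ≤ CK)
    (hρpos : ∀ x, 0 < ρ x) (hqpos : ∀ x, 0 < q x)
    (hρint : Integrable ρ) (hqint : Integrable q)
    (hu : ∀ x, ‖u x‖ ≤ Cu)
    (hLHS : Integrable (fun p : EuclideanSpace ℝ (Fin d) × EuclideanSpace ℝ (Fin d) =>
      K p.1 p.2 * q p.1 * (ρ p.2 - q p.2) * ⟪u p.2 - u p.1, v p.1 - u p.1⟫))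
    (hp : Integrable (fun y => ∫ z in ρ y..q y, (q y - z) / z))
    (hrel : Integrable (fun x => q x * ‖v x - u x‖ ^ 2)) :
    (∫ p : EuclideanSpace ℝ (Fin d) × EuclideanSpace ℝ (Fin d),
      K p.1 p.2 * q p.1 * (ρ p.2 - q p.2) * ⟪u p.2 - u p.1, v p.1 - u p.1⟫) ≤
      2 * CK * Cu * Real.sqrt (∫ x, q x) *
        Real.sqrt ((∫ x, q x) + ∫ x, ρ x) *
        Real.sqrt (∫ y, ∫ z in ρ y..q y, (q y - z) / z) *
        Real.sqrt (∫ x, q x * ‖v x - u x‖ ^ 2) := by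
  have hCK : 0 ≤ CK := (hK0 0 0).trans (hKC 0 0)
  have hCu : 0 ≤ Cu := (norm_nonneg _).trans (hu 0)
  rcases hCK.eq_or_lt with h0 | hCKp
  · have hK : ∀ x y, K x y = 0 := fun x y => le_antisymm (h0 ▸ hKC x y) (hK0 x y)
    simp [hK, ← h0]
  set G : EuclideanSpace ℝ (Fin d) × EuclideanSpace ℝ (Fin d) → ℝ := fun p =>
      K p.1 p.2 * q p.1 * (ρ p.2 - q p.2) * ⟪u p.2 - u p.1, v p.1 - u p.1⟫ with hG
  set p : EuclideanSpace ℝ (Fin d) → ℝ := fun y => ∫ z in ρ y..q y, (q y - z) / z with hpdef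
  set W : EuclideanSpace ℝ (Fin d) → ℝ := fun x => ‖v x - u x‖ with hW
  have hW0 : ∀ x, 0 ≤ W x := fun x => norm_nonneg _
  have hqm := hqint.aemeasurable
  have hρm := hρint.aemeasurable
  have hWm : AEMeasurable W := by
    have : W = fun x => √((q x * ‖v x - u x‖ ^ 2) / q x) := by
      ext x
      rw [mul_div_cancel_left₀ _ (hqpos x).ne', Real.sqrt_sq (norm_nonneg _)]
    rw [this]
    exact (hrel.aemeasurable.div hqm).sqrt
  have hkl : ∀ y, (ρ y - q y) ^ 2 ≤ (√(q y) + √(ρ y)) ^ 2 * p y := fun y =>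
    aux_kl (q y) (ρ y) (hqpos y) (hρpos y)
  have hmpos : ∀ y, 0 < √(q y) + √(ρ y) := fun y =>
    add_pos (Real.sqrt_pos.2 (hqpos y)) (Real.sqrt_pos.2 (hρpos y))
  have hp0 : ∀ y, 0 ≤ p y := fun y => by
    have h1 := (sq_nonneg _).trans (hkl y)
    exact nonneg_of_mul_nonneg_right h1 (pow_pos (hmpos y) 2)
  have hdl : ∀ y, |ρ y - q y| ≤ (√(q y) + √(ρ y)) * √(p y) := fun y => by
    refine abs_le_of_sq_le_sq ?_ (mul_nonneg (hmpos y).le (Real.sqrt_nonneg _))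
    rw [mul_pow, Real.sq_sqrt (hp0 y)]
    exact hkl y
  set T : EuclideanSpace ℝ (Fin d) × EuclideanSpace ℝ (Fin d) → ℝ := fun z => CK * (q z.1 * W z.1 * |ρ z.2 - q z.2|) with hT
  have hT0 : ∀ z, 0 ≤ T z := fun z =>
    mul_nonneg hCK (mul_nonneg (mul_nonneg (hqpos _).le (hW0 _)) (abs_nonneg _))
  have hGT : ∀ z, |G z| ≤ T z * ‖u z.1 - u z.2‖ := fun z => by
    have h1 : |(⟪u z.2 - u z.1, v z.1 - u z.1⟫ : ℝ)| ≤ ‖u z.1 - u z.2‖ * W z.1 := by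
      rw [norm_sub_rev (u z.1)]; exact abs_real_inner_le_norm _ _
    simp only [hG, hT, abs_mul, abs_of_nonneg (hK0 _ _), abs_of_pos (hqpos z.1)]
    have h2 := hKC z.1 z.2
    have h3 := hqpos z.1
    calc _ ≤ CK * q z.1 * |ρ z.2 - q z.2| * (‖u z.1 - u z.2‖ * W z.1) := by gcongr
      _ = _ := by ring
  set H : EuclideanSpace ℝ (Fin d) × EuclideanSpace ℝ (Fin d) → ℝ := fun z => |G z| / T z with hH
  have hH0 : ∀ z, 0 ≤ H z := fun z => div_nonneg (abs_nonneg _) (hT0 z)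
  have hHu : ∀ z, H z ≤ ‖u z.1 - u z.2‖ := fun z =>
    div_le_of_le_mul₀ (hT0 z) (norm_nonneg _) (by rw [mul_comm]; exact hGT z)
  have hGH : ∀ z, |G z| = T z * H z := fun z => by
    by_cases h : T z = 0
    · have := hGT z
      rw [h, zero_mul] at this ⊢
      exact le_antisymm this (abs_nonneg _)
    · simp only [hH]; field_simp
  have hTm : AEMeasurable T (volume.prod volume) :=
    (((hqm.comp_fst).mul (hWm.comp_fst)).mul
      ((hρm.sub hqm).abs.comp_snd)).const_mul CK
  have hHm : AEMeasurable H (volume.prod volume) := by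
    have : AEMeasurable G (volume.prod volume) := hLHS.aemeasurable
    exact this.abs.div hTm
  obtain ⟨hgi, hgle⟩ := aux_vol (volume : Measure (EuclideanSpace ℝ (Fin d))) (NeZero.ne _) q ρ u Cu hqint hρint hqpos hρpos
    hu H hHm.aestronglyMeasurable hH0 hHu
  set f : EuclideanSpace ℝ (Fin d) × EuclideanSpace ℝ (Fin d) → ℝ := fun z => √(q z.1) * W z.1 * √(p z.2) with hf
  set g : EuclideanSpace ℝ (Fin d) × EuclideanSpace ℝ (Fin d) → ℝ := fun z => √(q z.1) * (√(q z.2) + √(ρ z.2)) * H z with hg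
  have hf2 : ∀ z, f z ^ 2 = (q z.1 * ‖v z.1 - u z.1‖ ^ 2) * p z.2 := fun z => by
    simp only [hf, mul_pow, Real.sq_sqrt (hqpos z.1).le, Real.sq_sqrt (hp0 z.2), hW]
  have hg2 : ∀ z, g z ^ 2 = q z.1 * (√(q z.2) + √(ρ z.2)) ^ 2 * H z ^ 2 := fun z => by
    simp only [hg, mul_pow, Real.sq_sqrt (hqpos z.1).le]
  obtain ⟨hfgi, hfg⟩ := aux_cs (μ := (volume : Measure (EuclideanSpace ℝ (Fin d))).prod volume) f g
    (fun z => mul_nonneg (mul_nonneg (Real.sqrt_nonneg _) (hW0 _)) (Real.sqrt_nonneg _))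
    (fun z => mul_nonneg (mul_nonneg (Real.sqrt_nonneg _) (hmpos _).le) (hH0 z))
    ((((hqm.sqrt).comp_fst).mul hWm.comp_fst).mul (hp.aemeasurable.sqrt.comp_snd)).aestronglyMeasurable
    ((((hqm.sqrt).comp_fst).mul ((hqm.sqrt.add hρm.sqrt).comp_snd)).mul hHm).aestronglyMeasurable
    (by simp only [hf2]; exact hrel.mul_prod hp) (by simp only [hg2]; exact hgi)
  have hGfg : ∀ z, G z ≤ CK * (f z * g z) := fun z => by
    refine (le_abs_self _).trans ?_
    rw [hGH]
    have h1 := hdl z.2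
    have h2 := hqpos z.1
    have h3 := hW0 z.1
    have h4 := hH0 z
    calc T z * H z ≤ CK * (q z.1 * W z.1 * ((√(q z.2) + √(ρ z.2)) * √(p z.2))) * H z := by
          simp only [hT]; gcongr
      _ = CK * (√(q z.1) ^ 2 * W z.1 * ((√(q z.2) + √(ρ z.2)) * √(p z.2))) * H z := by
          rw [Real.sq_sqrt h2.le]
      _ = _ := by simp only [hf, hg]; ring
  have hfin : ∫ z, G z ≤ CK * ∫ z, f z * g z ∂((volume : Measure (EuclideanSpace ℝ (Fin d))).prod volume) := by
    rw [← integral_const_mul]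
    exact integral_mono hLHS (hfgi.const_mul CK) hGfg
  refine hfin.trans ?_
  simp only [hf2, hg2] at hfg
  rw [integral_prod_mul (fun x => q x * ‖v x - u x‖ ^ 2) p] at hfg
  have hrel0 : 0 ≤ ∫ x, q x * ‖v x - u x‖ ^ 2 :=
    integral_nonneg fun x => mul_nonneg (hqpos x).le (sq_nonneg _)
  have hQ0 : 0 ≤ ∫ x, q x := integral_nonneg fun x => (hqpos x).le
  have h5 := hfg.trans (mul_le_mul_of_nonneg_left (Real.sqrt_le_sqrt hgle) (Real.sqrt_nonneg _))
  rw [Real.sqrt_mul hrel0, Real.sqrt_mul (by positivity), Real.sqrt_mul (by positivity),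
    show 4 * Cu ^ 2 = (2 * Cu) ^ 2 by ring, Real.sqrt_sq (by positivity)] at h5
  refine (mul_le_mul_of_nonneg_left h5 hCK).trans (le_of_eq ?_)
  ring
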